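/- arXiv:0909.3002 — 2 statements merged into one kernel-verified Lean document; each statement's English description precedes it below -/
import Mathlib

section
/- For all positive real numbers α and β, F̃(α,β) = (1/α)·(Γ(α)Γ(β)/Γ(α+β))·₃F₂(α,α,1; α+1, α+β; 1), where the ₃F₂ series on the right-hand side converges. -/
/-- Pochhammer symbol (α, n) = α(α+1)⋯(α+n-1). -/
noncomputable def poch (α : ℝ) (n : ℕ) : ℝ := ∏ i ∈ Finset.range n, (α + i)

/-- F̃(α,β) = (Γ(α)Γ(β)/Γ(α+β+1)) · Σ_{m,n≥0} (α,m)(β,n)/(α+β+1, m+n). -/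
noncomputable def Ftilde (α β : ℝ) : ℝ :=
  (Real.Gamma α * Real.Gamma β / Real.Gamma (α + β + 1)) *
    ∑' p : ℕ × ℕ, poch α p.1 * poch β p.2 / poch (α + β + 1) (p.1 + p.2)

theorem poch_pos {a : ℝ} (ha : 0 < a) (n : ℕ) : 0 < poch a n :=
  Finset.prod_pos fun _ _ => by positivity

theorem poch_succ (a : ℝ) (n : ℕ) : poch a (n + 1) = poch a n * (a + n) :=
  Finset.prod_range_succ _ _

theorem poch_add (a : ℝ) (m n : ℕ) : poch a (m + n) = poch a m * poch (a + m) n := by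
  simp only [poch, Finset.prod_range_add, Nat.cast_add, add_assoc]

theorem mul_poch_add_one (a : ℝ) (n : ℕ) : a * poch (a + 1) n = poch a n * (a + n) := by
  rw [← poch_succ, add_comm n 1, poch_add]
  simp [poch]

theorem tendsto_poch_div_poch {a b : ℝ} (ha : 0 < a) (hab : a < b) :
    Filter.Tendsto (fun n => poch a n / poch b n) Filter.atTop (nhds 0) := by
  rw [← Filter.tendsto_add_atTop_iff_nat 1]
  have hpow : Filter.Tendsto (fun n : ℕ => (n : ℝ) ^ (-(b - a))) Filter.atTop (nhds 0) :=
    (tendsto_rpow_neg_atTop (sub_pos.2 hab)).comp tendsto_natCast_atTop_atTop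
  have hlim := ((Real.GammaSeq_tendsto_Gamma b).div (Real.GammaSeq_tendsto_Gamma a)
    (Real.Gamma_pos_of_pos ha).ne').mul hpow
  rw [mul_zero] at hlim
  refine hlim.congr' ?_
  filter_upwards [Filter.eventually_gt_atTop 0] with n hn
  have hn' : (0 : ℝ) < n := Nat.cast_pos.2 hn
  have hpa := poch_pos ha (n + 1)
  have hpb := poch_pos (ha.trans hab) (n + 1)
  have hfac : (0 : ℝ) < n.factorial := Nat.cast_pos.2 n.factorial_pos
  have hna := Real.rpow_pos_of_pos hn' a
  have hnb := Real.rpow_pos_of_pos hn' b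
  change (n : ℝ) ^ b * n.factorial / poch b (n + 1) /
    ((n : ℝ) ^ a * n.factorial / poch a (n + 1)) * (n : ℝ) ^ (-(b - a)) = _
  rw [neg_sub, Real.rpow_sub hn']
  field_simp

/-- Gauss's evaluation of `₂F₁(a, 1; b + 1; 1)`. -/
theorem hasSum_poch_div_poch {a b : ℝ} (ha : 0 < a) (hab : a < b) :
    HasSum (fun n => poch a n / poch (b + 1) n) (b / (b - a)) := by
  have hb := ha.trans hab
  have hsub := sub_pos.2 hab
  rw [hasSum_iff_tendsto_nat_of_nonneg
    fun n => (div_pos (poch_pos ha n) (poch_pos (by linarith) n)).le]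
  have hpartial (n : ℕ) : ∑ i ∈ Finset.range n, poch a i / poch (b + 1) i =
      b / (b - a) * (1 - poch a n / poch b n) := by
    induction n with
    | zero => simp [poch]
    | succ n ih =>
      have hpb := poch_pos hb n
      have hbn : 0 < b + n := by positivity
      have hshift : poch (b + 1) n = poch b n * (b + n) / b := by
        rw [← mul_poch_add_one]
        field_simp
      rw [Finset.sum_range_succ, ih, hshift, poch_succ, poch_succ]
      field_simp
      ring
  simp_rw [hpartial]
  simpa using ((tendsto_poch_div_poch ha hab).const_sub 1).const_mul (b / (b - a))

theorem hypergeometric_term_eq {α β : ℝ} (hα : 0 < α) (hβ : 0 < β) (n : ℕ) :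
    poch α n * poch α n * poch 1 n / (poch (α + 1) n * poch (α + β) n * poch 1 n) =
      α / (α + β) * (poch α n / poch (α + β + 1) n * ((α + β + n) / (α + n))) := by
  have hpα := poch_pos hα n
  have hp1 := poch_pos one_pos n
  have hpαβ := poch_pos (add_pos hα hβ) n
  have hαn : 0 < α + n := by positivity
  have hαβn : 0 < α + β + n := by positivity
  have hαβ : 0 < α + β := by positivity
  have h₁ : poch (α + 1) n = poch α n * (α + n) / α := by
    rw [← mul_poch_add_one]
    field_simp
  have h₂ : poch (α + β + 1) n = poch (α + β) n * (α + β + n) / (α + β) := by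
    rw [← mul_poch_add_one]
    field_simp
  rw [h₁, h₂]
  field_simp

theorem summable_single_series {α β : ℝ} (hα : 0 < α) (hβ : 0 < β) :
    Summable fun n : ℕ => poch α n / poch (α + β + 1) n * ((α + β + n) / (α + n)) := by
  have hpos (n : ℕ) : 0 < poch α n / poch (α + β + 1) n :=
    div_pos (poch_pos hα n) (poch_pos (by positivity) n)
  refine Summable.of_nonneg_of_le (fun n => mul_nonneg (hpos n).le (by positivity)) (fun n => ?_)
    ((hasSum_poch_div_poch hα (lt_add_of_pos_right α hβ)).summable.mul_right ((α + β) / α))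
  refine mul_le_mul_of_nonneg_left ?_ (hpos n).le
  rw [div_le_div_iff₀ (by positivity) hα]
  nlinarith [mul_nonneg hβ.le n.cast_nonneg (α := ℝ)]

theorem hasSum_inner_series {α β : ℝ} (hα : 0 < α) (hβ : 0 < β) (m : ℕ) :
    HasSum (fun n => poch α m * poch β n / poch (α + β + 1) (m + n))
      (poch α m / poch (α + β + 1) m * ((α + β + m) / (α + m))) := by
  have hlt : β < α + β + m := by linarith [m.cast_nonneg (α := ℝ)]
  have hsum := (hasSum_poch_div_poch hβ hlt).mul_left (poch α m / poch (α + β + 1) m)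
  rw [show α + β + m - β = α + m by ring] at hsum
  rw [add_right_comm (α + β)] at hsum
  simpa only [poch_add, mul_div_mul_comm] using hsum

theorem tsum_double_series {α β : ℝ} (hα : 0 < α) (hβ : 0 < β) :
    ∑' p : ℕ × ℕ, poch α p.1 * poch β p.2 / poch (α + β + 1) (p.1 + p.2) =
      ∑' n : ℕ, poch α n / poch (α + β + 1) n * ((α + β + n) / (α + n)) := by
  have hinner := hasSum_inner_series hα hβ
  have hsum : Summable fun p : ℕ × ℕ =>
      poch α p.1 * poch β p.2 / poch (α + β + 1) (p.1 + p.2) := by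
    refine (summable_prod_of_nonneg fun p => ?_).2 ⟨fun m => (hinner m).summable, ?_⟩
    · exact (div_pos (mul_pos (poch_pos hα _) (poch_pos hβ _)) (poch_pos (by positivity) _)).le
    · simpa only [(hinner _).tsum_eq] using summable_single_series hα hβ
  rw [hsum.tsum_prod]
  exact tsum_congr fun m => (hinner m).tsum_eq

theorem stmt6 (α β : ℝ) (hα : 0 < α) (hβ : 0 < β) :
    Summable (fun n : ℕ =>
      poch α n * poch α n * poch 1 n / (poch (α + 1) n * poch (α + β) n * poch 1 n)) ∧
    Ftilde α β =
      (1 / α) * (Real.Gamma α * Real.Gamma β / Real.Gamma (α + β)) *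
        ∑' n : ℕ,
          poch α n * poch α n * poch 1 n / (poch (α + 1) n * poch (α + β) n * poch 1 n) := by
  simp_rw [hypergeometric_term_eq hα hβ]
  refine ⟨(summable_single_series hα hβ).mul_left _, ?_⟩
  rw [Ftilde, tsum_double_series hα hβ, tsum_mul_left, Real.Gamma_add_one (add_pos hα hβ).ne']
  have hΓ := Real.Gamma_pos_of_pos (add_pos hα hβ)
  field_simp
end

section
/- Define F₇^{a,b} = F̃(a/7, b/7) − F̃((7−a)/7, (7−b)/7) for integers 1 ≤ a, b ≤ 6, and set s = −F₇^{1,2}/sin(4π/7), t = F₇^{2,4}/sin(6π/7), u = −F₇^{4,1}/sin(2π/7). Then s³ + t³ + u³ − 3stu ≠ 0. -/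
/-- F₇^{a,b} = F̃(a/7, b/7) − F̃((7−a)/7, (7−b)/7). -/
noncomputable def F7 (a b : ℝ) : ℝ := Ftilde (a / 7) (b / 7) - Ftilde ((7 - a) / 7) ((7 - b) / 7)

theorem Gamma_add_natCast_eq_poch {x : ℝ} (hx : 0 < x) (n : ℕ) :
    Real.Gamma (x + n) = poch x n * Real.Gamma x := by
  induction n with
  | zero => simp [poch]
  | succ n ih =>
    have h : x + (n + 1 : ℕ) = (x + n) + 1 := by push_cast; ring
    rw [h, Real.Gamma_add_one (by positivity), ih, poch, poch, Finset.prod_range_succ]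
    ring

/-- The Dirichlet integral `∫∫ u ^ (x - 1) * v ^ (y - 1)` over the simplex `u + v < 1`. -/
noncomputable def dirichlet (x y : ℝ) : ℝ :=
  Real.Gamma x * Real.Gamma y / Real.Gamma (x + y + 1)

theorem dirichlet_pos {x y : ℝ} (hx : 0 < x) (hy : 0 < y) : 0 < dirichlet x y :=
  div_pos (mul_pos (Real.Gamma_pos_of_pos hx) (Real.Gamma_pos_of_pos hy))
    (Real.Gamma_pos_of_pos (by positivity))

theorem dirichlet_comm (x y : ℝ) : dirichlet x y = dirichlet y x := by
  rw [dirichlet, dirichlet, mul_comm, add_comm x y]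

/-- Ratios of shifted Gamma values are antitone, by log-convexity. -/
theorem Gamma_mul_Gamma_add_le {x x' z : ℝ} (hx : 0 < x) (hxx' : x ≤ x') (hz : 0 < z) :
    Real.Gamma x' * Real.Gamma (x + z) ≤ Real.Gamma x * Real.Gamma (x' + z) := by
  have hx' : 0 < x' := hx.trans_le hxx'
  rcases hxx'.eq_or_lt with rfl | hlt
  · rfl
  have hd : 0 < x' + z - x := by linarith
  have hne : x' + z - x ≠ 0 := hd.ne'
  have hp : 0 ≤ z / (x' + z - x) := by positivity
  have hq : 0 ≤ (x' - x) / (x' + z - x) := div_nonneg (by linarith) hd.le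
  have hpq : z / (x' + z - x) + (x' - x) / (x' + z - x) = 1 := by
    field_simp; ring
  have hqp : (x' - x) / (x' + z - x) + z / (x' + z - x) = 1 := by rw [add_comm, hpq]
  have mem : ∀ {w : ℝ}, 0 < w → w ∈ Set.Ioi (0 : ℝ) := fun h => h
  have h1 := Real.convexOn_log_Gamma.2 (mem hx) (mem (add_pos hx' hz)) hp hq hpq
  have h2 := Real.convexOn_log_Gamma.2 (mem hx) (mem (add_pos hx' hz)) hq hp hqp
  have e1 : z / (x' + z - x) * x + (x' - x) / (x' + z - x) * (x' + z) = x' := by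
    field_simp; ring
  have e2 : (x' - x) / (x' + z - x) * x + z / (x' + z - x) * (x' + z) = x + z := by
    field_simp; ring
  simp only [smul_eq_mul, Function.comp_apply] at h1 h2
  rw [e1] at h1
  rw [e2] at h2
  have g1 := Real.Gamma_pos_of_pos hx
  have g2 := Real.Gamma_pos_of_pos hx'
  have g3 := Real.Gamma_pos_of_pos (add_pos hx hz)
  have g4 := Real.Gamma_pos_of_pos (add_pos hx' hz)
  rw [← Real.log_le_log_iff (by positivity) (by positivity), Real.log_mul g2.ne' g3.ne',
    Real.log_mul g1.ne' g4.ne']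
  calc _ ≤ _ := add_le_add h1 h2
    _ = (z / (x' + z - x) + (x' - x) / (x' + z - x)) *
        (Real.log (Real.Gamma x) + Real.log (Real.Gamma (x' + z))) := by ring
    _ = _ := by rw [hpq, one_mul]

theorem dirichlet_lt_left {x x' y : ℝ} (hx : 0 < x) (hxx' : x < x') (hy : 0 < y) :
    dirichlet x' y < dirichlet x y := by
  have hx' : 0 < x' := hx.trans hxx'
  have h := Gamma_mul_Gamma_add_le (x := x + 1) (x' := x' + 1) (by linarith) (by linarith) hy
  rw [Real.Gamma_add_one hx.ne', Real.Gamma_add_one hx'.ne', add_right_comm x, add_right_comm x']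
    at h
  have g1 := Real.Gamma_pos_of_pos hx
  have g2 := Real.Gamma_pos_of_pos hx'
  have g3 := Real.Gamma_pos_of_pos (show 0 < x + y + 1 by positivity)
  have g4 := Real.Gamma_pos_of_pos (show 0 < x' + y + 1 by positivity)
  have gy := Real.Gamma_pos_of_pos hy
  have key : Real.Gamma x' * Real.Gamma (x + y + 1) < Real.Gamma x * Real.Gamma (x' + y + 1) := by
    refine lt_of_mul_lt_mul_left (a := x) ?_ hx.le
    calc _ < x' * (Real.Gamma x' * Real.Gamma (x + y + 1)) := by gcongr
      _ ≤ _ := by linarith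
  rw [dirichlet, dirichlet, div_lt_div_iff₀ g4 g3]
  linarith [mul_lt_mul_of_pos_left key gy]

/-- A nonnegative series whose terms are bounded by the differences of a nonnegative sequence. -/
theorem summable_of_telescoping {f u : ℕ → ℝ} (hf : ∀ n, 0 ≤ f n) (hu : ∀ n, 0 ≤ u n)
    (h : ∀ n, f n ≤ u n - u (n + 1)) : Summable f ∧ ∑' n, f n ≤ u 0 := by
  have hs : ∀ n, ∑ i ∈ Finset.range n, f i ≤ u 0 := fun n =>
    calc _ ≤ ∑ i ∈ Finset.range n, (u i - u (i + 1)) := Finset.sum_le_sum fun i _ => h i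
      _ = u 0 - u n := Finset.sum_range_sub' u n
      _ ≤ u 0 := by linarith [hu n]
  exact ⟨summable_of_sum_range_le hf hs, Real.tsum_le_of_sum_range_le hf hs⟩

theorem dirichlet_row {x y : ℝ} (hx : 0 < x) (hy : 0 < y) :
    Summable (fun n : ℕ => dirichlet x (y + n)) ∧
      ∑' n : ℕ, dirichlet x (y + n) ≤ Real.Gamma x * Real.Gamma y / Real.Gamma (x + y) / x := by
  have hyn : ∀ n : ℕ, 0 < y + n := fun n => by positivity
  have key := summable_of_telescoping (f := fun n : ℕ => dirichlet x (y + n))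
    (u := fun n : ℕ => Real.Gamma x * Real.Gamma (y + n) / Real.Gamma (x + (y + n)) / x)
    (fun n => (dirichlet_pos hx (hyn n)).le)
    (fun n => by
      have := Real.Gamma_pos_of_pos hx
      have := Real.Gamma_pos_of_pos (hyn n)
      have := Real.Gamma_pos_of_pos (add_pos hx (hyn n))
      positivity)
    (fun n => le_of_eq (by
      have h1 : x + (y + (n + 1 : ℕ)) = x + (y + n) + 1 := by push_cast; ring
      have h2 : y + (n + 1 : ℕ) = y + n + 1 := by push_cast; ring
      have hxy := add_pos hx (hyn n)
      have g := (Real.Gamma_pos_of_pos hxy).ne'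
      simp only [dirichlet]
      rw [h1, h2, Real.Gamma_add_one (hyn n).ne', Real.Gamma_add_one hxy.ne']
      have := hxy.ne'
      have := hx.ne'
      field_simp
      ring))
  simpa using key

theorem summable_dirichlet {α β : ℝ} (hα : 0 < α) (hβ : 0 < β) :
    Summable (fun p : ℕ × ℕ => dirichlet (α + p.1) (β + p.2)) := by
  have hαm : ∀ m : ℕ, 0 < α + m := fun m => by positivity
  have hβn : ∀ n : ℕ, 0 < β + n := fun n => by positivity
  refine (summable_prod_of_nonneg fun p => (dirichlet_pos (hαm p.1) (hβn p.2)).le).2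
    ⟨fun m => (dirichlet_row (hαm m) hβ).1, ?_⟩
  let u : ℕ → ℝ := fun m => (α + β) / α * (Real.Gamma (α + m) * Real.Gamma β /
    Real.Gamma (α + m + β)) / β
  refine (summable_of_telescoping (u := u)
    (fun m => tsum_nonneg fun n => (dirichlet_pos (hαm m) (hβn n)).le) (fun m => ?_)
    (fun m => (dirichlet_row (hαm m) hβ).2.trans ?_)).1
  · have := Real.Gamma_pos_of_pos (hαm m)
    have := Real.Gamma_pos_of_pos hβ
    have := Real.Gamma_pos_of_pos (add_pos (hαm m) hβ)
    positivity
  · have h1 : α + (m + 1 : ℕ) = α + m + 1 := by push_cast; ring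
    have h2 : α + m + 1 + β = α + m + β + 1 := by ring
    have hs := add_pos (hαm m) hβ
    have g1 := Real.Gamma_pos_of_pos (hαm m)
    have g2 := Real.Gamma_pos_of_pos hβ
    have g3 := Real.Gamma_pos_of_pos hs
    have hu : u m - u (m + 1) = Real.Gamma (α + m) * Real.Gamma β / Real.Gamma (α + m + β) *
        ((α + β) / α / (α + m + β)) := by
      simp only [u]
      rw [h1, h2, Real.Gamma_add_one (hαm m).ne', Real.Gamma_add_one hs.ne']
      have := hs.ne'
      field_simp
      ring
    rw [hu, div_eq_mul_inv _ (α + m)]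
    refine mul_le_mul_of_nonneg_left ?_ (by positivity)
    rw [div_div, inv_eq_one_div, div_le_div_iff₀ (hαm m) (by positivity)]
    have : 0 ≤ β * m := by positivity
    linarith

theorem Ftilde_eq_tsum {α β : ℝ} (hα : 0 < α) (hβ : 0 < β) :
    Ftilde α β = ∑' p : ℕ × ℕ, dirichlet (α + p.1) (β + p.2) := by
  rw [Ftilde, ← tsum_mul_left]
  refine tsum_congr fun p => ?_
  have h : α + p.1 + (β + p.2) + 1 = α + β + 1 + (p.1 + p.2 : ℕ) := by push_cast; ring
  rw [dirichlet, h, Gamma_add_natCast_eq_poch hα, Gamma_add_natCast_eq_poch hβ,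
    Gamma_add_natCast_eq_poch (by positivity), div_mul_div_comm]
  congr 1 <;> ring

theorem Ftilde_comm {α β : ℝ} (hα : 0 < α) (hβ : 0 < β) : Ftilde α β = Ftilde β α := by
  rw [Ftilde_eq_tsum hα hβ, Ftilde_eq_tsum hβ hα, ← (Equiv.prodComm ℕ ℕ).tsum_eq]
  exact tsum_congr fun p => dirichlet_comm _ _

theorem Ftilde_lt_left {α α' β : ℝ} (hα : 0 < α) (h : α < α') (hβ : 0 < β) :
    Ftilde α' β < Ftilde α β := by
  have hα' := hα.trans h
  have hlt : ∀ p : ℕ × ℕ, dirichlet (α' + p.1) (β + p.2) < dirichlet (α + p.1) (β + p.2) :=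
    fun p => dirichlet_lt_left (by positivity) (by linarith) (by positivity)
  rw [Ftilde_eq_tsum hα hβ, Ftilde_eq_tsum hα' hβ]
  exact (summable_dirichlet hα' hβ).tsum_lt_tsum (i := (0, 0)) (fun p => (hlt p).le) (hlt _)
    (summable_dirichlet hα hβ)

theorem Ftilde_lt_right {α β β' : ℝ} (hα : 0 < α) (hβ : 0 < β) (h : β < β') :
    Ftilde α β' < Ftilde α β := by
  rw [Ftilde_comm hα hβ, Ftilde_comm hα (hβ.trans h)]
  exact Ftilde_lt_left hβ h hα

theorem F7_two_four_pos : 0 < F7 2 4 := by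
  have h1 : Ftilde (5 / 7) (3 / 7) = Ftilde (3 / 7) (5 / 7) :=
    Ftilde_comm (by norm_num) (by norm_num)
  have h2 : Ftilde (3 / 7) (5 / 7) < Ftilde (2 / 7) (5 / 7) :=
    Ftilde_lt_left (by norm_num) (by norm_num) (by norm_num)
  have h3 : Ftilde (2 / 7) (5 / 7) < Ftilde (2 / 7) (4 / 7) :=
    Ftilde_lt_right (by norm_num) (by norm_num) (by norm_num)
  norm_num [F7]
  linarith

theorem F7_two_four_lt_one_two : F7 2 4 < F7 1 2 := by
  have h1 : Ftilde (2 / 7) (4 / 7) < Ftilde (1 / 7) (4 / 7) :=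
    Ftilde_lt_left (by norm_num) (by norm_num) (by norm_num)
  have h2 : Ftilde (1 / 7) (4 / 7) < Ftilde (1 / 7) (2 / 7) :=
    Ftilde_lt_right (by norm_num) (by norm_num) (by norm_num)
  have h3 : Ftilde (6 / 7) (5 / 7) < Ftilde (5 / 7) (5 / 7) :=
    Ftilde_lt_left (by norm_num) (by norm_num) (by norm_num)
  have h4 : Ftilde (5 / 7) (5 / 7) < Ftilde (5 / 7) (3 / 7) :=
    Ftilde_lt_right (by norm_num) (by norm_num) (by norm_num)
  norm_num [F7]
  linarith

theorem F7_two_four_lt_four_one : F7 2 4 < F7 4 1 := by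
  have h1 : Ftilde (2 / 7) (4 / 7) = Ftilde (4 / 7) (2 / 7) :=
    Ftilde_comm (by norm_num) (by norm_num)
  have h2 : Ftilde (4 / 7) (2 / 7) < Ftilde (4 / 7) (1 / 7) :=
    Ftilde_lt_right (by norm_num) (by norm_num) (by norm_num)
  have h3 : Ftilde (5 / 7) (3 / 7) = Ftilde (3 / 7) (5 / 7) :=
    Ftilde_comm (by norm_num) (by norm_num)
  have h4 : Ftilde (3 / 7) (6 / 7) < Ftilde (3 / 7) (5 / 7) :=
    Ftilde_lt_right (by norm_num) (by norm_num) (by norm_num)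
  norm_num [F7]
  linarith

/-- The heptagonal triangle identity. -/
theorem inv_sin_six_pi_div_seven :
    (Real.sin (6 * Real.pi / 7))⁻¹ =
      (Real.sin (4 * Real.pi / 7))⁻¹ + (Real.sin (2 * Real.pi / 7))⁻¹ := by
  have hpi := Real.pi_pos
  have h6 : Real.sin (6 * Real.pi / 7) = Real.sin (Real.pi / 7) := by
    rw [← Real.sin_pi_sub]; congr 1; ring
  have h2 : Real.sin (2 * Real.pi / 7) = 2 * Real.sin (Real.pi / 7) * Real.cos (Real.pi / 7) := by
    rw [← Real.sin_two_mul]; congr 1; ring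
  have h4 : Real.sin (4 * Real.pi / 7) = Real.sin (3 * Real.pi / 7) := by
    rw [← Real.sin_pi_sub]; congr 1; ring
  have hsum : Real.sin (4 * Real.pi / 7) + Real.sin (2 * Real.pi / 7) =
      2 * Real.sin (3 * Real.pi / 7) * Real.cos (Real.pi / 7) := by
    have ha : 4 * Real.pi / 7 = 3 * Real.pi / 7 + Real.pi / 7 := by ring
    have hb : 2 * Real.pi / 7 = 3 * Real.pi / 7 - Real.pi / 7 := by ring
    rw [ha, hb, Real.sin_add, Real.sin_sub]
    ring
  have p2 : Real.sin (2 * Real.pi / 7) ≠ 0 :=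
    (Real.sin_pos_of_pos_of_lt_pi (by positivity) (by linarith)).ne'
  have p4 : Real.sin (4 * Real.pi / 7) ≠ 0 :=
    (Real.sin_pos_of_pos_of_lt_pi (by positivity) (by linarith)).ne'
  have p6 : Real.sin (6 * Real.pi / 7) ≠ 0 :=
    (Real.sin_pos_of_pos_of_lt_pi (by positivity) (by linarith)).ne'
  rw [← h4] at hsum
  rw [← h6] at h2
  rw [inv_add_inv p4 p2, inv_eq_one_div, div_eq_div_iff p6 (mul_ne_zero p4 p2)]
  linear_combination Real.sin (4 * Real.pi / 7) * h2 - Real.sin (6 * Real.pi / 7) * hsum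

theorem sum_cubes_sub_ne_zero {s t u : ℝ} (hsum : s + t + u ≠ 0) (hst : s ≠ t) :
    s ^ 3 + t ^ 3 + u ^ 3 - 3 * s * t * u ≠ 0 := by
  have h : s ^ 3 + t ^ 3 + u ^ 3 - 3 * s * t * u =
      (s + t + u) * (((s - t) ^ 2 + (t - u) ^ 2 + (u - s) ^ 2) / 2) := by ring
  have hpos : 0 < (s - t) ^ 2 := sq_pos_of_ne_zero (sub_ne_zero.2 hst)
  rw [h]
  exact mul_ne_zero hsum (by positivity)

theorem stmt19 :
    (-(F7 1 2) / Real.sin (4 * Real.pi / 7)) ^ 3 + (F7 2 4 / Real.sin (6 * Real.pi / 7)) ^ 3 +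
        (-(F7 4 1) / Real.sin (2 * Real.pi / 7)) ^ 3 -
      3 * (-(F7 1 2) / Real.sin (4 * Real.pi / 7)) * (F7 2 4 / Real.sin (6 * Real.pi / 7)) *
        (-(F7 4 1) / Real.sin (2 * Real.pi / 7)) ≠ 0 := by
  have hpi := Real.pi_pos
  have p2 := inv_pos.2 (Real.sin_pos_of_pos_of_lt_pi
    (show 0 < 2 * Real.pi / 7 by positivity) (by linarith))
  have p4 := inv_pos.2 (Real.sin_pos_of_pos_of_lt_pi
    (show 0 < 4 * Real.pi / 7 by positivity) (by linarith))
  have hA := F7_two_four_pos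
  have hB := F7_two_four_lt_one_two
  have hC := F7_two_four_lt_four_one
  simp only [div_eq_mul_inv _ (Real.sin _)]
  rw [inv_sin_six_pi_div_seven]
  have h4 := mul_lt_mul_of_pos_right hB p4
  have h2 := mul_lt_mul_of_pos_right hC p2
  have hA4 := mul_pos hA p4
  have hA2 := mul_pos hA p2
  refine sum_cubes_sub_ne_zero (ne_of_lt ?_) (ne_of_lt ?_)
  · linarith
  · linarith
end
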